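/- Let P be a homogeneous simplicial d-complex with integer vertices in ℝ^d, let w be a nonnegative integer and let f ∈ C^{w+1}(ℝ^d). Then there exist real numbers γ_k for 0 < k ≤ w/2 and a constant C (depending on f, P and w) such that for every positive integer N, | S_N(f,P) − ∫_P f(x) dx − Σ_{0<k≤w/2} γ_k N^{−2k} | ≤ C N^{−w−1}. -/

import Mathlib

open scoped Real Topology
open MeasureTheory Filter

/-- The Euclidean unit ball `{ y : |y| ≤ 1 }` in `ℝ^d`. -/
def eball (d : ℕ) : Set (Fin d → ℝ) := {y | ∑ i, (y i) ^ 2 ≤ 1}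

/-- The normalized solid angle `ω_P(x)`, defined as the limit of the relative measures of
`P` in small balls centred at `x`. -/
noncomputable def solidAngle (d : ℕ) (P : Set (Fin d → ℝ)) (x : Fin d → ℝ) : ℝ :=
  limUnder (𝓝[>] (0 : ℝ))
    (fun ε : ℝ => (volume (eball d)).toReal⁻¹ *
      ∫ y in eball d, P.indicator (fun _ => (1 : ℝ)) (x - ε • y))

/-- The weighted Riemann sum `S_N(f,P) = N^{-d} Σ_{n∈ℤ^d} ω_P(n/N) f(n/N)`. -/
noncomputable def SN (d : ℕ) (N : ℕ) (f : (Fin d → ℝ) → ℝ) (P : Set (Fin d → ℝ)) : ℝ :=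
  (N : ℝ) ^ (-(d : ℤ)) *
    ∑' n : Fin d → ℤ,
      solidAngle d P (fun i => (n i : ℝ) / N) * f (fun i => (n i : ℝ) / N)

/-- `F N` agrees with `a` plus a combination of `N⁻²ᵏ`, `1 ≤ k ≤ w / 2`, up to `O(N⁻ʷ⁻¹)`. -/
def HasEvenExpansion (w : ℕ) (F : ℕ → ℝ) (a : ℝ) : Prop :=
  ∃ γ : ℕ → ℝ, ∃ C : ℝ, ∀ N : ℕ, 0 < N →
    |F N - a - ∑ k ∈ Finset.Icc 1 (w / 2), γ k * ((N : ℝ)⁻¹) ^ (2 * k)| ≤ C * ((N : ℝ)⁻¹) ^ (w + 1)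

namespace HasEvenExpansion

variable {w : ℕ} {F G : ℕ → ℝ} {a b : ℝ}

theorem congr (h : HasEvenExpansion w F a) (hFG : ∀ N, 0 < N → G N = F N) :
    HasEvenExpansion w G a := by
  obtain ⟨γ, C, hC⟩ := h
  exact ⟨γ, C, fun N hN => by rw [hFG N hN]; exact hC N hN⟩

theorem add (hF : HasEvenExpansion w F a) (hG : HasEvenExpansion w G b) :
    HasEvenExpansion w (fun N => F N + G N) (a + b) := by
  obtain ⟨γ, C, hC⟩ := hF
  obtain ⟨γ', C', hC'⟩ := hG
  refine ⟨γ + γ', C + C', fun N hN => ?_⟩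
  have h := (abs_add_le _ _).trans (add_le_add (hC N hN) (hC' N hN))
  refine le_of_eq_of_le ?_ (h.trans_eq ?_)
  · congr 1
    simp only [Pi.add_apply, add_mul, Finset.sum_add_distrib]
    ring
  · ring

theorem const_mul (hF : HasEvenExpansion w F a) (c : ℝ) :
    HasEvenExpansion w (fun N => c * F N) (c * a) := by
  obtain ⟨γ, C, hC⟩ := hF
  refine ⟨fun k => c * γ k, |c| * C, fun N hN => ?_⟩
  have h := mul_le_mul_of_nonneg_left (hC N hN) (abs_nonneg c)
  rw [← abs_mul] at h
  refine le_of_eq_of_le ?_ (h.trans_eq ?_)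
  · congr 1
    simp only [mul_sub, Finset.mul_sum, mul_assoc]
  · ring

theorem of_isBigO {C : ℝ} (h : ∀ N : ℕ, 0 < N → |F N - a| ≤ C * ((N : ℝ)⁻¹) ^ (w + 1)) :
    HasEvenExpansion w F a :=
  ⟨0, C, by simpa using h⟩

theorem sum {ι : Type*} (s : Finset ι) {F : ι → ℕ → ℝ} {a : ι → ℝ}
    (h : ∀ i ∈ s, HasEvenExpansion w (F i) (a i)) :
    HasEvenExpansion w (fun N => ∑ i ∈ s, F i N) (∑ i ∈ s, a i) := by
  classical
  induction s using Finset.induction_on with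
  | empty => exact of_isBigO (C := 0) (by simp)
  | insert i s hi ih =>
    simp only [Finset.sum_insert hi]
    exact (h i (by simp)).add (ih fun j hj => h j (by simp [hj]))

theorem shift {v k : ℕ} (hk : 1 ≤ k) (hw : v + 2 * k = w) (hF : HasEvenExpansion v F a) :
    HasEvenExpansion w (fun N => ((N : ℝ)⁻¹) ^ (2 * k) * F N) 0 := by
  obtain ⟨γ, C, hC⟩ := hF
  refine ⟨fun l => if l < k then 0 else if l = k then a else γ (l - k), C, fun N hN => ?_⟩
  have hx : (0 : ℝ) ≤ ((N : ℝ)⁻¹) ^ (2 * k) := by positivity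
  have h := mul_le_mul_of_nonneg_left (hC N hN) hx
  rw [← abs_of_nonneg hx, ← abs_mul, abs_of_nonneg hx] at h
  have hs : ∑ l ∈ Finset.Icc 1 (w / 2), (if l < k then 0 else if l = k then a else γ (l - k)) *
      ((N : ℝ)⁻¹) ^ (2 * l) = ((N : ℝ)⁻¹) ^ (2 * k) * a + ∑ l ∈ Finset.Icc 1 (v / 2),
        ((N : ℝ)⁻¹) ^ (2 * k) * (γ l * ((N : ℝ)⁻¹) ^ (2 * l)) := by
    have hw2 : w / 2 = v / 2 + k := by omega
    have e1 : Finset.Icc 1 (w / 2) =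
        Finset.Ico 1 k ∪ insert k ((Finset.Icc 1 (v / 2)).map (addRightEmbedding k)) := by
      ext l
      simp only [Finset.map_add_right_Icc, Finset.mem_union, Finset.mem_insert, Finset.mem_Icc,
        Finset.mem_Ico]
      omega
    rw [e1, Finset.sum_union, Finset.sum_insert, Finset.sum_map, Finset.sum_eq_zero, zero_add]
    · congr 1
      · simp [mul_comm]
      · refine Finset.sum_congr rfl fun l hl => ?_
        have := (Finset.mem_Icc.1 hl).1
        simp only [addRightEmbedding_apply, Nat.add_sub_cancel]
        rw [if_neg (by omega), if_neg (by omega)]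
        ring
    · intro l hl
      rw [if_pos (Finset.mem_Ico.1 hl).2, zero_mul]
    · simp only [Finset.map_add_right_Icc, Finset.mem_Icc]; omega
    · rw [Finset.disjoint_left]
      intro l
      simp only [Finset.map_add_right_Icc, Finset.mem_insert, Finset.mem_Icc,
        Finset.mem_Ico]
      omega
  rw [hs, ← Finset.mul_sum]
  refine le_of_eq_of_le ?_ (h.trans_eq ?_)
  · congr 1; ring
  · subst hw; ring

end HasEvenExpansion

section Taylor

variable {E : Type*} [NormedAddCommGroup E] [NormedSpace ℝ E]

theorem iteratedDeriv_comp_line {g : E → ℝ} {n : ℕ} {m : ℕ∞} (hg : ContDiff ℝ m g) (hn : n ≤ m)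
    (x p : E) (t : ℝ) :
    iteratedDeriv n (fun t : ℝ => g (x + t • p)) t =
      iteratedFDeriv ℝ n g (x + t • p) (fun _ => p) := by
  have hc : ContDiff ℝ m (fun y => g (x + y)) := by fun_prop
  have h := (ContinuousLinearMap.toSpanSingleton ℝ p).iteratedFDeriv_comp_right (i := n)
    hc t (by exact_mod_cast hn)
  rw [iteratedDeriv_eq_iteratedFDeriv]
  have e : (fun t : ℝ => g (x + t • p)) =
    (fun y => g (x + y)) ∘ (ContinuousLinearMap.toSpanSingleton ℝ p) := by
    ext; simp
  rw [e, h, iteratedFDeriv_comp_add_left]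
  simp

theorem exists_taylor_bound [FiniteDimensional ℝ E] {w : ℕ} {g : E → ℝ}
    (hg : ContDiff ℝ (w + 1) g) (R : ℝ) :
    ∃ C : ℝ, ∀ x ∈ Metric.closedBall (0 : E) R, ∀ p ∈ Metric.closedBall (0 : E) R,
      ∀ h ∈ Set.Icc (0 : ℝ) 1,
        |g (x + h • p) - ∑ i ∈ Finset.range (w + 1),
          h ^ i / (i.factorial : ℝ) * iteratedFDeriv ℝ i g x (fun _ => p)| ≤ C * h ^ (w + 1) := by
  have hg' : ContDiff ℝ ((w + 1 : ℕ) : ℕ∞) g := by exact_mod_cast hg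
  have : ProperSpace E := FiniteDimensional.proper_real E
  obtain ⟨M, hM⟩ := (isCompact_closedBall (0 : E) (R + R)).exists_bound_of_continuousOn
    (hg'.continuous_iteratedFDeriv (m := w + 1) (by norm_cast)).continuousOn
  refine ⟨M * R ^ (w + 1) / (w.factorial : ℝ), fun x hx p hp h hh => ?_⟩
  rw [mem_closedBall_zero_iff] at hx hp
  have hφ : ContDiff ℝ ((w + 1 : ℕ) : ℕ∞) (fun t : ℝ => g (x + t • p)) := by fun_prop
  have key : ∀ i ≤ w + 1, ∀ y ∈ Set.Icc (0 : ℝ) 1,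
      iteratedDerivWithin i (fun t : ℝ => g (x + t • p)) (Set.Icc 0 1) y =
        iteratedFDeriv ℝ i g (x + y • p) (fun _ => p) := by
    intro i hi y hy
    rw [iteratedDerivWithin_eq_iteratedDeriv (uniqueDiffOn_Icc zero_lt_one)
      ((hφ.of_le (by exact_mod_cast hi)).contDiffAt) hy,
      iteratedDeriv_comp_line hg' (by exact_mod_cast hi)]
  have hb := taylor_mean_remainder_bound (f := fun t : ℝ => g (x + t • p)) (n := w)
    (C := M * R ^ (w + 1)) zero_le_one (by exact_mod_cast hφ.contDiffOn) hh (by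
      intro y hy
      rw [key _ le_rfl y hy]
      refine (ContinuousMultilinearMap.le_opNorm _ _).trans ?_
      rw [Finset.prod_const, Finset.card_univ, Fintype.card_fin]
      have hmem : x + y • p ∈ Metric.closedBall (0 : E) (R + R) := by
        rw [mem_closedBall_zero_iff]
        refine (norm_add_le _ _).trans (add_le_add hx ?_)
        rw [norm_smul, Real.norm_of_nonneg hy.1]
        exact (mul_le_of_le_one_left (norm_nonneg _) hy.2).trans hp
      have := hM _ hmem
      gcongr
      exact (norm_nonneg _).trans this)
  rw [taylor_within_apply, Real.norm_eq_abs] at hb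
  convert hb using 1
  · congr 2
    refine Finset.sum_congr rfl fun i hi => ?_
    rw [key i (by simp at hi; omega) 0 (by simp)]
    simp only [sub_zero, zero_smul, add_zero, smul_eq_mul]
    ring
  · simp only [sub_zero]; ring

end Taylor

section sampleMean

variable {X J : Type*} [Fintype J] (z : J → X)

/-- The arithmetic mean of `F` over a finite family of points. -/
noncomputable def sampleMean (F : X → ℝ) : ℝ :=
  (Fintype.card J : ℝ)⁻¹ * ∑ j, F (z j)

theorem sampleMean_sub (F G : X → ℝ) :
    sampleMean z (fun x => F x - G x) = sampleMean z F - sampleMean z G := by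
  simp [sampleMean, Finset.sum_sub_distrib, mul_sub]

theorem sampleMean_sum {ι : Type*} (s : Finset ι) (c : ι → ℝ) (F : ι → X → ℝ) :
    sampleMean z (fun x => ∑ i ∈ s, c i * F i x) = ∑ i ∈ s, c i * sampleMean z (F i) := by
  simp only [sampleMean, Finset.mul_sum]
  rw [Finset.sum_comm]
  exact Finset.sum_congr rfl fun i _ => Finset.sum_congr rfl fun j _ => by ring

theorem abs_sampleMean_le {F : X → ℝ} {M : ℝ} (hM : 0 ≤ M) (h : ∀ j, |F (z j)| ≤ M) :
    |sampleMean z F| ≤ M := by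
  rw [sampleMean, abs_mul, abs_inv, Nat.abs_cast]
  calc (Fintype.card J : ℝ)⁻¹ * |∑ j, F (z j)|
      ≤ (Fintype.card J : ℝ)⁻¹ * ∑ _j : J, M := by
        gcongr
        exact (Finset.abs_sum_le_sum_abs _ _).trans (Finset.sum_le_sum fun j _ => h j)
    _ = (Fintype.card J : ℝ)⁻¹ * (Fintype.card J : ℝ) * M := by simp; ring
    _ ≤ 1 * M := by gcongr; exact inv_mul_le_one
    _ = M := one_mul M

end sampleMean

/-- A normalized even functional on continuous functions, bounded by the sup norm over the ball
of radius `R`. -/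
structure IsSymmMean {E : Type*} [NormedAddCommGroup E] (Λ : C(E, ℝ) →ₗ[ℝ] ℝ) (R : ℝ) : Prop where
  bound : ∀ (f : C(E, ℝ)) (M : ℝ), (∀ p ∈ Metric.closedBall (0 : E) R, |f p| ≤ M) → |Λ f| ≤ M
  neg : ∀ f : C(E, ℝ), Λ (f.comp ⟨fun p => -p, continuous_neg⟩) = Λ f
  one : Λ 1 = 1

/-- Evaluation at the origin. -/
def evalZero {E : Type*} [NormedAddCommGroup E] : C(E, ℝ) →ₗ[ℝ] ℝ where
  toFun f := f 0
  map_add' _ _ := rfl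
  map_smul' _ _ := rfl

theorem isSymmMean_evalZero {E : Type*} [NormedAddCommGroup E] {R : ℝ} (hR : 0 ≤ R) :
    IsSymmMean (evalZero (E := E)) R where
  bound f M h := h 0 (by simpa using hR)
  neg f := by simp [evalZero]
  one := rfl

section SymmMean

variable {E : Type*} [NormedAddCommGroup E] [NormedSpace ℝ E]

/-- The rescaling `p ↦ g (x + h • p)`. -/
def rescale (g : C(E, ℝ)) (x : E) (h : ℝ) : C(E, ℝ) := ⟨fun p => g (x + h • p), by fun_prop⟩

/-- Restriction of a multilinear map to the diagonal, as a linear map. -/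
def diagonalForm (i : ℕ) : (E [×i]→L[ℝ] ℝ) →ₗ[ℝ] C(E, ℝ) where
  toFun T := ⟨fun p => T fun _ => p, by fun_prop⟩
  map_add' _ _ := rfl
  map_smul' _ _ := rfl

theorem abs_diagonalForm_le {i : ℕ} (T : E [×i]→L[ℝ] ℝ) {R : ℝ} {p : E}
    (hp : p ∈ Metric.closedBall (0 : E) R) : |diagonalForm i T p| ≤ R ^ i * ‖T‖ := by
  rw [mem_closedBall_zero_iff] at hp
  refine (T.le_opNorm _).trans ?_
  rw [Finset.prod_const, Finset.card_univ, Fintype.card_fin, mul_comm]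
  gcongr

/-- The `i`-th moment of a mean, as a continuous functional on multilinear maps. -/
noncomputable def IsSymmMean.moment {Λ : C(E, ℝ) →ₗ[ℝ] ℝ} {R : ℝ} (hΛ : IsSymmMean Λ R) (i : ℕ) :
    (E [×i]→L[ℝ] ℝ) →L[ℝ] ℝ :=
  (Λ ∘ₗ diagonalForm i).mkContinuous (R ^ i) fun T =>
    hΛ.bound _ _ fun _ hp => abs_diagonalForm_le T hp

theorem IsSymmMean.moment_zero {Λ : C(E, ℝ) →ₗ[ℝ] ℝ} {R : ℝ} (hΛ : IsSymmMean Λ R)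
    (T : E [×0]→L[ℝ] ℝ) : hΛ.moment 0 T = T 0 := by
  have : diagonalForm 0 T = T 0 • (1 : C(E, ℝ)) := by
    ext p
    simp only [ContinuousMap.smul_apply, ContinuousMap.one_apply, smul_eq_mul, mul_one]
    exact congrArg T (Subsingleton.elim _ _)
  change Λ (diagonalForm 0 T) = _
  rw [this, map_smul, hΛ.one, smul_eq_mul, mul_one]

theorem IsSymmMean.moment_odd {Λ : C(E, ℝ) →ₗ[ℝ] ℝ} {R : ℝ} (hΛ : IsSymmMean Λ R) {i : ℕ}
    (hi : Odd i) (T : E [×i]→L[ℝ] ℝ) : hΛ.moment i T = 0 := by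
  have h : (diagonalForm i T).comp ⟨fun p => -p, continuous_neg⟩ = -diagonalForm i T := by
    ext p
    have := T.map_smul_univ (fun _ => (-1 : ℝ)) (fun _ => p)
    simpa [hi.neg_one_pow, diagonalForm] using this
  have h2 := hΛ.neg (diagonalForm i T)
  rw [h, map_neg] at h2
  change Λ (diagonalForm i T) = 0
  linarith

theorem IsSymmMean.exists_taylor_bound [FiniteDimensional ℝ E] {Λ : C(E, ℝ) →ₗ[ℝ] ℝ} {R : ℝ}
    (hΛ : IsSymmMean Λ R) {w : ℕ} {g : C(E, ℝ)} (hg : ContDiff ℝ (w + 1) g) :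
    ∃ C : ℝ, ∀ x ∈ Metric.closedBall (0 : E) R, ∀ h ∈ Set.Icc (0 : ℝ) 1,
      |Λ (rescale g x h) - ∑ i ∈ Finset.range (w + 1),
        h ^ i / (i.factorial : ℝ) * hΛ.moment i (iteratedFDeriv ℝ i g x)| ≤ C * h ^ (w + 1) := by
  obtain ⟨C, hC⟩ := _root_.exists_taylor_bound hg R
  refine ⟨C, fun x hx h hh => ?_⟩
  have := hΛ.bound (rescale g x h - ∑ i ∈ Finset.range (w + 1),
    (h ^ i / (i.factorial : ℝ)) • diagonalForm i (iteratedFDeriv ℝ i g x)) (C * h ^ (w + 1))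
    fun p hp => by
      simpa [ContinuousMap.sum_apply, rescale, diagonalForm] using hC x hx p hp h hh
  simp only [map_sub, map_sum, map_smul, smul_eq_mul] at this
  exact this

/-- If a family of sample means, smeared at scale `1 / N` by some symmetric mean `Λ₀`, computes a
functional `I` exactly, then smearing by any other symmetric mean computes `I` up to an expansion
in even powers of `1 / N`. -/
theorem hasEvenExpansion_sampleMean [FiniteDimensional ℝ E] {J : ℕ → Type*} [∀ N, Fintype (J N)]
    (z : ∀ N, J N → E) {R : ℝ} (hR : 0 ≤ R)
    (hz : ∀ N, 0 < N → ∀ j, z N j ∈ Metric.closedBall (0 : E) R)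
    {Λ₀ : C(E, ℝ) →ₗ[ℝ] ℝ} (hΛ₀ : IsSymmMean Λ₀ R) (I : C(E, ℝ) → ℝ)
    (hI : ∀ g : C(E, ℝ), ∀ N : ℕ, 0 < N →
      sampleMean (z N) (fun x => Λ₀ (rescale g x (N : ℝ)⁻¹)) = I g)
    (w : ℕ) {Λ : C(E, ℝ) →ₗ[ℝ] ℝ} (hΛ : IsSymmMean Λ R) (g : C(E, ℝ))
    (hg : ContDiff ℝ (w + 1) g) :
    HasEvenExpansion w (fun N => sampleMean (z N) (fun x => Λ (rescale g x (N : ℝ)⁻¹))) (I g) := by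
  induction w using Nat.strong_induction_on generalizing Λ g with
  | _ w ih =>
  set φ : ℕ → E → ℝ := fun i x =>
    (hΛ.moment i - hΛ₀.moment i) (iteratedFDeriv ℝ i g x) with hφ
  set G : ℕ → ℝ := fun N => ∑ i ∈ Finset.range (w + 1),
    ((N : ℝ)⁻¹ ^ i / (i.factorial : ℝ)) * sampleMean (z N) (φ i) with hG
  obtain ⟨C, hC⟩ := hΛ.exists_taylor_bound hg
  obtain ⟨C₀, hC₀⟩ := hΛ₀.exists_taylor_bound hg
  have hrem : ∀ N : ℕ, 0 < N →
      |(sampleMean (z N) (fun x => Λ (rescale g x (N : ℝ)⁻¹)) - G N) - I g| ≤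
        (|C| + |C₀|) * ((N : ℝ)⁻¹) ^ (w + 1) := by
    intro N hN
    have hN1 : (N : ℝ)⁻¹ ∈ Set.Icc (0 : ℝ) 1 :=
      ⟨by positivity, inv_le_one_of_one_le₀ (by exact_mod_cast hN)⟩
    simp only [hG]
    rw [← hI g N hN, ← sampleMean_sum, ← sampleMean_sub, ← sampleMean_sub]
    refine abs_sampleMean_le _ (by positivity) fun j => ?_
    have h1 := hC _ (hz N hN j) _ hN1
    have h2 := hC₀ _ (hz N hN j) _ hN1
    have h3 := (abs_sub _ _).trans (add_le_add h1 h2)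
    refine le_of_eq_of_le ?_ (h3.trans ?_)
    · congr 1
      simp only [hφ, sub_apply, mul_sub, Finset.sum_sub_distrib]
      ring
    · rw [← add_mul]
      gcongr <;> exact le_abs_self _
  have hGexp : HasEvenExpansion w G 0 := by
    have : HasEvenExpansion w G (∑ i ∈ Finset.range (w + 1), 0) := by
      refine HasEvenExpansion.sum _ fun i hi => ?_
      have hzero : (∀ T, hΛ.moment i T = hΛ₀.moment i T) → HasEvenExpansion w
          (fun N : ℕ => ((N : ℝ)⁻¹ ^ i / (i.factorial : ℝ)) * sampleMean (z N) (φ i)) 0 := by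
        intro h
        refine HasEvenExpansion.of_isBigO (C := 0) fun N _ => ?_
        simp [hφ, h, sampleMean]
      rcases Nat.even_or_odd' i with ⟨k, rfl | rfl⟩
      · rcases Nat.eq_zero_or_pos k with rfl | hk
        · exact hzero fun T => by rw [hΛ.moment_zero T, hΛ₀.moment_zero T]
        · have hkw : 2 * k ≤ w := by simpa [Nat.lt_succ_iff] using hi
          have hcd : ContDiff ℝ ((w - 2 * k : ℕ) + 1) (φ (2 * k)) := by
            refine (hΛ.moment (2 * k) - hΛ₀.moment (2 * k)).contDiff.comp
              (hg.iteratedFDeriv_right ?_)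
            norm_cast
            omega
          have h := ih (w - 2 * k) (by omega) (isSymmMean_evalZero hR)
            ⟨φ (2 * k), hcd.continuous⟩ hcd
          have h' := (h.shift hk (by omega : w - 2 * k + 2 * k = w)).const_mul
            ((2 * k).factorial : ℝ)⁻¹
          rw [mul_zero] at h'
          refine h'.congr fun N _ => ?_
          simp only [evalZero, rescale, LinearMap.coe_mk, AddHom.coe_mk, ContinuousMap.coe_mk,
            smul_zero, add_zero]
          ring
      · exact hzero fun T => by rw [hΛ.moment_odd ⟨k, rfl⟩ T, hΛ₀.moment_odd ⟨k, rfl⟩ T]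
    simpa using this
  have := (HasEvenExpansion.of_isBigO hrem).add hGexp
  rw [add_zero] at this
  exact this.congr fun N _ => by ring

end SymmMean

section SolidAngle

variable {d : ℕ}

theorem neg_mem_eball {y : Fin d → ℝ} : -y ∈ eball d ↔ y ∈ eball d := by
  simp [eball]

theorem norm_le_one_of_mem_eball {y : Fin d → ℝ} (hy : y ∈ eball d) : ‖y‖ ≤ 1 := by
  refine (pi_norm_le_iff_of_nonneg zero_le_one).2 fun i => ?_
  have h : (y i) ^ 2 ≤ ∑ i, (y i) ^ 2 :=
    Finset.single_le_sum (f := fun i => (y i) ^ 2) (fun i _ => sq_nonneg _) (Finset.mem_univ i)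
  exact abs_le_one_iff_mul_self_le_one.2 (by nlinarith [show ∑ i, (y i) ^ 2 ≤ 1 from hy])

theorem measurableSet_euclideanBall : MeasurableSet (eball d) :=
  (isClosed_le (by fun_prop) continuous_const).measurableSet

theorem volume_eball_lt_top : volume (eball d) < ⊤ :=
  (measure_mono fun _ hy => mem_closedBall_zero_iff.2 (norm_le_one_of_mem_eball hy)).trans_lt
    (measure_closedBall_lt_top (x := (0 : Fin d → ℝ)) (r := 1))

theorem volume_eball_toReal_pos : 0 < (volume (eball d)).toReal := by
  refine ENNReal.toReal_pos (fun h => ?_) volume_eball_lt_top.ne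
  have ho : IsOpen {y : Fin d → ℝ | ∑ i, (y i) ^ 2 < 1} :=
    isOpen_lt (by fun_prop) continuous_const
  refine (ho.measure_pos volume ⟨0, by simp⟩).ne' (measure_mono_null (fun y hy => ?_) h)
  exact le_of_lt (show ∑ i, (y i) ^ 2 < 1 from hy)

/-- The relative measure of `P` in the ball of radius `ε` around `x`. -/
noncomputable def relAngle (P : Set (Fin d → ℝ)) (x : Fin d → ℝ) (ε : ℝ) : ℝ :=
  (volume (eball d)).toReal⁻¹ * ∫ y in eball d, P.indicator (fun _ => (1 : ℝ)) (x - ε • y)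

theorem solidAngle_eq_of_tendsto {P : Set (Fin d → ℝ)} {x : Fin d → ℝ} {a : ℝ}
    (h : Tendsto (relAngle P x) (𝓝[>] 0) (𝓝 a)) : solidAngle d P x = a :=
  h.limUnder_eq

theorem integrableOn_indicator_comp {P : Set (Fin d → ℝ)} (hP : MeasurableSet P)
    (x : Fin d → ℝ) (ε : ℝ) :
    IntegrableOn (fun y => P.indicator (fun _ => (1 : ℝ)) (x - ε • y)) (eball d) := by
  refine Measure.integrableOn_of_bounded (M := 1) volume_eball_lt_top.ne ?_ ?_
  · exact ((measurable_const.indicator hP).comp (by fun_prop)).aestronglyMeasurable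
  · refine ae_of_all _ fun y => ?_
    by_cases h : x - ε • y ∈ P <;> simp [h]

theorem tendsto_relAngle {P : Set (Fin d → ℝ)} (hc : Convex ℝ P) (hP : MeasurableSet P)
    (x : Fin d → ℝ) : Tendsto (relAngle P x) (𝓝[>] 0) (𝓝 (solidAngle d P x)) := by
  have key : ∀ y : Fin d → ℝ, ∃ b : ℝ, Tendsto
      (fun ε : ℝ => P.indicator (fun _ => (1 : ℝ)) (x - ε • y)) (𝓝[>] 0) (𝓝 b) := by
    intro y
    by_cases h : ∃ᶠ ε in 𝓝[>] (0 : ℝ), x - ε • y ∈ P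
    · refine ⟨1, tendsto_const_nhds.congr' ?_⟩
      obtain ⟨ε₀, hε₀, hpos⟩ := (h.and_eventually self_mem_nhdsWithin).exists
      filter_upwards [Ioo_mem_nhdsGT hpos] with ε hε
      obtain ⟨ε₁, hε₁, hlt⟩ := (h.and_eventually (Ioo_mem_nhdsGT hε.1)).exists
      have hle : 0 < ε₀ - ε₁ := by linarith [hlt.2, hε.2]
      have hmem := hc hε₀ hε₁ (a := (ε - ε₁) / (ε₀ - ε₁)) (b := (ε₀ - ε) / (ε₀ - ε₁))
        (div_nonneg (by linarith [hlt.2]) hle.le) (div_nonneg (by linarith [hε.2]) hle.le)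
        (by field_simp; ring)
      have e : ((ε - ε₁) / (ε₀ - ε₁)) • (x - ε₀ • y) + ((ε₀ - ε) / (ε₀ - ε₁)) • (x - ε₁ • y) =
          x - ε • y := by
        ext i
        simp only [Pi.add_apply, Pi.smul_apply, Pi.sub_apply, smul_eq_mul]
        field_simp
        ring
      rw [e] at hmem
      simp [hmem]
    · refine ⟨0, tendsto_const_nhds.congr' ?_⟩
      filter_upwards [not_frequently.1 h] with ε hε
      simp [hε]
  choose b hb using key
  have hlim : Tendsto (relAngle P x) (𝓝[>] 0)
      (𝓝 ((volume (eball d)).toReal⁻¹ * ∫ y in eball d, b y)) := by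
    refine Tendsto.const_mul _ ?_
    refine tendsto_integral_filter_of_dominated_convergence (fun _ => 1) ?_ ?_ ?_ ?_
    · exact Eventually.of_forall fun ε => (integrableOn_indicator_comp hP x ε).1
    · refine Eventually.of_forall fun ε => ae_of_all _ fun y => ?_
      by_cases h : x - ε • y ∈ P <;> simp [h]
    · exact integrableOn_const volume_eball_lt_top.ne
    · exact ae_of_all _ hb
  rwa [solidAngle_eq_of_tendsto hlim]

theorem eventually_forall_sub_smul_mem {U : Set (Fin d → ℝ)} {x : Fin d → ℝ} (hU : U ∈ 𝓝 x) :
    ∀ᶠ ε in 𝓝[>] (0 : ℝ), ∀ y ∈ eball d, x - ε • y ∈ U := by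
  obtain ⟨r, hr, hrU⟩ := Metric.mem_nhds_iff.1 hU
  filter_upwards [Ioo_mem_nhdsGT hr] with ε hε y hy
  refine hrU ?_
  rw [mem_ball_iff_norm, sub_sub_cancel_left, norm_neg, norm_smul, Real.norm_of_nonneg hε.1.le]
  exact (mul_le_of_le_one_right hε.1.le (norm_le_one_of_mem_eball hy)).trans_lt hε.2

theorem solidAngle_congr {P Q U : Set (Fin d → ℝ)} {x : Fin d → ℝ} (hU : U ∈ 𝓝 x)
    (h : ∀ u ∈ U, u ∈ P ↔ u ∈ Q) : solidAngle d P x = solidAngle d Q x := by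
  have : relAngle P x =ᶠ[𝓝[>] 0] relAngle Q x := by
    filter_upwards [eventually_forall_sub_smul_mem hU] with ε hε
    refine congrArg _ (setIntegral_congr_fun measurableSet_euclideanBall fun y hy => ?_)
    by_cases hy' : x - ε • y ∈ P
    · simp [hy', (h _ (hε y hy)).1 hy']
    · simp [hy', mt (h _ (hε y hy)).2 hy']
  exact congrArg lim (map_congr this)

theorem solidAngle_empty (x : Fin d → ℝ) : solidAngle d ∅ x = 0 :=
  solidAngle_eq_of_tendsto (tendsto_const_nhds.congr fun ε => by simp [relAngle])

theorem solidAngle_univ (x : Fin d → ℝ) : solidAngle d Set.univ x = 1 := by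
  refine solidAngle_eq_of_tendsto (tendsto_const_nhds.congr fun ε => ?_)
  have : volume.real (eball d) ≠ 0 := volume_eball_toReal_pos.ne'
  simp [relAngle, Measure.real] at this ⊢
  field_simp

theorem solidAngle_of_notMem {P : Set (Fin d → ℝ)} (hP : IsClosed P) {x : Fin d → ℝ}
    (hx : x ∉ P) : solidAngle d P x = 0 := by
  rw [solidAngle_congr (hP.isOpen_compl.mem_nhds hx) (Q := ∅) (by simp), solidAngle_empty]

theorem solidAngle_of_mem_interior {P : Set (Fin d → ℝ)} {x : Fin d → ℝ}
    (hx : x ∈ interior P) : solidAngle d P x = 1 := by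
  rw [solidAngle_congr (isOpen_interior.mem_nhds hx) (Q := Set.univ)
    (fun u hu => by simp [interior_subset hu]), solidAngle_univ]

theorem relAngle_nonneg (P : Set (Fin d → ℝ)) (x : Fin d → ℝ) (ε : ℝ) : 0 ≤ relAngle P x ε :=
  mul_nonneg (inv_nonneg.2 ENNReal.toReal_nonneg)
    (integral_nonneg fun _ => Set.indicator_nonneg (fun _ _ => zero_le_one) _)

theorem relAngle_le_one {P : Set (Fin d → ℝ)} (hP : MeasurableSet P) (x : Fin d → ℝ) (ε : ℝ) :
    relAngle P x ε ≤ 1 := by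
  have h : ∫ y in eball d, P.indicator (fun _ => (1 : ℝ)) (x - ε • y) ≤ ∫ _y in eball d, (1 : ℝ) :=
    integral_mono (integrableOn_indicator_comp hP x ε)
      (integrableOn_const volume_eball_lt_top.ne)
      fun y => Set.indicator_le_self' (fun _ _ => zero_le_one) _
  rw [relAngle, inv_mul_le_iff₀ volume_eball_toReal_pos]
  simpa [Measure.real] using h

theorem solidAngle_nonneg {P : Set (Fin d → ℝ)} (hc : Convex ℝ P) (hP : MeasurableSet P)
    (x : Fin d → ℝ) : 0 ≤ solidAngle d P x :=
  ge_of_tendsto' (tendsto_relAngle hc hP x) (relAngle_nonneg P x)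

theorem solidAngle_le_one {P : Set (Fin d → ℝ)} (hc : Convex ℝ P) (hP : MeasurableSet P)
    (x : Fin d → ℝ) : solidAngle d P x ≤ 1 :=
  le_of_tendsto' (tendsto_relAngle hc hP x) (relAngle_le_one hP x)

theorem solidAngle_preimage {P : Set (Fin d → ℝ)} (hc : Convex ℝ P) (hP : MeasurableSet P)
    {c : ℝ} (hc0 : 0 < c) (a x : Fin d → ℝ) :
    solidAngle d {u | c • u - a ∈ P} x = solidAngle d P (c • x - a) := by
  refine solidAngle_eq_of_tendsto ?_
  have hmul : Tendsto (fun ε : ℝ => c * ε) (𝓝[>] 0) (𝓝[>] 0) := by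
    refine tendsto_nhdsWithin_iff.2 ⟨?_, ?_⟩
    · exact ((continuous_const_mul c).tendsto' 0 0 (mul_zero c)).mono_left nhdsWithin_le_nhds
    · filter_upwards [self_mem_nhdsWithin] with ε hε using mul_pos hc0 hε
  refine ((tendsto_relAngle hc hP (c • x - a)).comp hmul).congr fun ε => ?_
  refine congrArg _ (integral_congr_ae (ae_of_all _ fun y => ?_))
  have e : c • x - a - (c * ε) • y = c • (x - ε • y) - a := by
    rw [smul_sub, mul_smul]; abel
  simp only [e]
  rfl

theorem solidAngle_sub_left {P : Set (Fin d → ℝ)} {c : Fin d → ℝ}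
    (h : ∀ u, c - u ∈ P ↔ u ∈ P) (x : Fin d → ℝ) :
    solidAngle d P (c - x) = solidAngle d P x := by
  have : relAngle P (c - x) = relAngle P x := by
    ext ε
    refine congrArg ((volume (eball d)).toReal⁻¹ * ·) ?_
    have hneg := (Measure.measurePreserving_neg
      (volume : Measure (Fin d → ℝ))).setIntegral_preimage_emb
      (MeasurableEquiv.neg (Fin d → ℝ)).measurableEmbedding
      (fun y => P.indicator (fun _ => (1 : ℝ)) (x - ε • y)) (eball d)
    have hpre : Neg.neg ⁻¹' eball d = eball d := Set.ext fun y => neg_mem_eball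
    rw [hpre] at hneg
    rw [← hneg]
    refine integral_congr_ae (ae_of_all _ fun y => ?_)
    have e : c - x - ε • y = c - (x - ε • -y) := by rw [smul_neg]; abel
    by_cases hy : x - ε • -y ∈ P
    · simp only [e, Set.indicator_of_mem hy, Set.indicator_of_mem ((h _).2 hy)]
    · simp only [e, Set.indicator_of_notMem hy, Set.indicator_of_notMem (mt (h _).1 hy)]
  exact congrArg (fun F => limUnder (𝓝[>] 0) F) this

theorem indicator_biUnion_ae_eq {X ι : Type*} [MeasurableSpace X] {μ : Measure X} (s : Finset ι)
    {P : ι → Set X} (hd : ∀ i ∈ s, ∀ j ∈ s, i ≠ j → μ (P i ∩ P j) = 0) :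
    (⋃ i ∈ s, P i).indicator (fun _ => (1 : ℝ)) =ᵐ[μ]
      fun x => ∑ i ∈ s, (P i).indicator (fun _ => (1 : ℝ)) x := by
  have hall : ∀ᵐ x ∂μ, ∀ i ∈ s, ∀ j ∈ s, i ≠ j → x ∉ P i ∩ P j := by
    rw [Finset.eventually_all]
    intro i hi
    rw [Finset.eventually_all]
    intro j hj
    by_cases hij : i = j
    · exact ae_of_all _ fun x h => absurd hij h
    · filter_upwards [measure_eq_zero_iff_ae_notMem.1 (hd i hi j hj hij)] with x hx _ using hx
  filter_upwards [hall] with x hx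
  by_cases h : x ∈ ⋃ i ∈ s, P i
  · obtain ⟨i, hi, hxi⟩ := Set.mem_iUnion₂.1 h
    rw [Set.indicator_of_mem h, Finset.sum_eq_single_of_mem i hi, Set.indicator_of_mem hxi]
    exact fun j hj hji => Set.indicator_of_notMem (fun hxj => hx j hj i hi hji ⟨hxj, hxi⟩) _
  · rw [Set.indicator_of_notMem h, Finset.sum_eq_zero]
    exact fun i hi => Set.indicator_of_notMem (fun hxi => h (Set.mem_iUnion₂.2 ⟨i, hi, hxi⟩)) _

theorem setIntegral_biUnion_of_null {X ι : Type*} [MeasurableSpace X] {μ : Measure X}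
    (s : Finset ι) {P : ι → Set X} (hP : ∀ i ∈ s, MeasurableSet (P i))
    (hd : ∀ i ∈ s, ∀ j ∈ s, i ≠ j → μ (P i ∩ P j) = 0) {f : X → ℝ}
    (hf : ∀ i ∈ s, IntegrableOn f (P i) μ) :
    ∫ x in ⋃ i ∈ s, P i, f x ∂μ = ∑ i ∈ s, ∫ x in P i, f x ∂μ := by
  have e : ∀ Q : Set X, Q.indicator f = fun x => Q.indicator (fun _ => (1 : ℝ)) x * f x := by
    intro Q
    ext x
    by_cases h : x ∈ Q <;> simp [h]
  rw [← integral_indicator (s.measurableSet_biUnion hP)]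
  calc ∫ x, (⋃ i ∈ s, P i).indicator f x ∂μ
      = ∫ x, ∑ i ∈ s, (P i).indicator f x ∂μ := by
        refine integral_congr_ae ?_
        filter_upwards [indicator_biUnion_ae_eq s hd] with x hx
        simp only [e, hx, Finset.sum_mul]
    _ = ∑ i ∈ s, ∫ x in P i, f x ∂μ := by
        rw [integral_finsetSum _ fun i hi => (integrable_indicator_iff (hP i hi)).2 (hf i hi)]
        exact Finset.sum_congr rfl fun i hi => integral_indicator (hP i hi)

theorem solidAngle_biUnion {ι : Type*} (s : Finset ι) {P : ι → Set (Fin d → ℝ)}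
    (hc : ∀ i ∈ s, Convex ℝ (P i)) (hP : ∀ i ∈ s, MeasurableSet (P i))
    (hd : ∀ i ∈ s, ∀ j ∈ s, i ≠ j → volume (P i ∩ P j) = 0) (x : Fin d → ℝ) :
    solidAngle d (⋃ i ∈ s, P i) x = ∑ i ∈ s, solidAngle d (P i) x := by
  refine solidAngle_eq_of_tendsto
    ((tendsto_finsetSum s fun i hi => tendsto_relAngle (hc i hi) (hP i hi) x).congr' ?_)
  filter_upwards [self_mem_nhdsWithin] with ε hε
  have hε : ε ≠ 0 := ne_of_gt hε
  have hq : Measure.QuasiMeasurePreserving (fun y : Fin d → ℝ => x - ε • y) volume volume := by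
    refine (Measure.measurePreserving_sub_left volume x).quasiMeasurePreserving.comp
      ⟨by fun_prop, ?_⟩
    rw [Measure.map_addHaar_smul volume hε]
    exact Measure.smul_absolutelyContinuous
  simp only [relAngle, ← Finset.mul_sum]
  congr 1
  rw [← integral_finsetSum _ fun i hi => integrableOn_indicator_comp (hP i hi) x ε]
  refine integral_congr_ae (ae_restrict_of_ae ?_)
  filter_upwards [hq.ae (indicator_biUnion_ae_eq s hd)] with y hy using hy.symm

end SolidAngle

section RiemannSum

variable {d : ℕ}

/-- An integer vector, seen as a real vector. -/
def intVec (n : Fin d → ℤ) : Fin d → ℝ := fun i => n i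

theorem intVec_injective : Function.Injective (intVec (d := d)) := fun _ _ h =>
  funext fun i => Int.cast_injective (congrFun h i)

theorem intVec_add (m n : Fin d → ℤ) : intVec (m + n) = intVec m + intVec n := by
  ext i; simp [intVec]

theorem intVec_sub (m n : Fin d → ℤ) : intVec (m - n) = intVec m - intVec n := by
  ext i; simp [intVec]

theorem SN_eq (N : ℕ) (f : (Fin d → ℝ) → ℝ) (P : Set (Fin d → ℝ)) :
    SN d N f P = ((N : ℝ) ^ d)⁻¹ * ∑' n : Fin d → ℤ,
      solidAngle d P ((N : ℝ)⁻¹ • intVec n) * f ((N : ℝ)⁻¹ • intVec n) := by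
  have e : ∀ n : Fin d → ℤ, (fun i => (n i : ℝ) / N) = (N : ℝ)⁻¹ • intVec n := fun n => by
    ext i; simp [intVec, div_eq_inv_mul]
  simp only [SN, e, zpow_neg, zpow_natCast]

theorem finite_smul_intVec_mem {P : Set (Fin d → ℝ)} (hP : Bornology.IsBounded P) {c : ℝ}
    (hc : c ≠ 0) : {n : Fin d → ℤ | c • intVec n ∈ P}.Finite := by
  obtain ⟨r, hr⟩ := hP.subset_closedBall 0
  obtain ⟨m, hm⟩ := exists_nat_ge (|c|⁻¹ * r)
  refine (Set.finite_Icc (fun _ : Fin d => -(m : ℤ)) (fun _ => (m : ℤ))).subset fun n hn => ?_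
  have hn' := mem_closedBall_zero_iff.1 (hr hn)
  have hi : ∀ i, |n i| ≤ (m : ℤ) := fun i => by
    have h1 := (norm_le_pi_norm (c • intVec n) i).trans hn'
    simp only [Pi.smul_apply, smul_eq_mul, intVec, norm_mul, Real.norm_eq_abs] at h1
    have h2 : |(n i : ℝ)| ≤ m := by
      refine le_trans ?_ hm
      rwa [le_inv_mul_iff₀ (abs_pos.2 hc)]
    exact_mod_cast h2
  exact ⟨fun i => (abs_le.1 (hi i)).1, fun i => (abs_le.1 (hi i)).2⟩

theorem finite_support_SN {P : Set (Fin d → ℝ)} (hP : IsCompact P) (f : (Fin d → ℝ) → ℝ) {N : ℕ}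
    (hN : 0 < N) : (Function.support fun n : Fin d → ℤ =>
      solidAngle d P ((N : ℝ)⁻¹ • intVec n) * f ((N : ℝ)⁻¹ • intVec n)).Finite := by
  have hN' : (N : ℝ)⁻¹ ≠ 0 := by positivity
  refine (finite_smul_intVec_mem hP.isBounded hN').subset fun n hn => ?_
  by_contra h
  exact hn (by simp only [solidAngle_of_notMem hP.isClosed h, zero_mul])

theorem SN_eq_sum {ι : Type*} (s : Finset ι) {P : Set (Fin d → ℝ)} {f : (Fin d → ℝ) → ℝ}
    {Q : ι → Set (Fin d → ℝ)} {g : ι → (Fin d → ℝ) → ℝ} (hQ : ∀ i ∈ s, IsCompact (Q i))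
    (h : ∀ x, solidAngle d P x * f x = ∑ i ∈ s, solidAngle d (Q i) x * g i x) {N : ℕ}
    (hN : 0 < N) : SN d N f P = ∑ i ∈ s, SN d N (g i) (Q i) := by
  simp only [SN_eq, h, ← Finset.mul_sum]
  rw [Summable.tsum_finsetSum]
  exact fun i hi => summable_of_hasFiniteSupport (finite_support_SN (hQ i hi) (g i) hN)

open scoped Pointwise in
theorem card_smul_intVec_mem (P : Set (Fin d → ℝ)) {N : ℕ} (hN : 0 < N) :
    Nat.card ↑(P ∩ (N : ℝ)⁻¹ •
      (Submodule.span ℤ (Set.range (Pi.basisFun ℝ (Fin d))) : Set (Fin d → ℝ))) =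
      {n : Fin d → ℤ | (N : ℝ)⁻¹ • intVec n ∈ P}.ncard := by
  have hN' : (N : ℝ)⁻¹ ≠ 0 := by positivity
  have hinj : Function.Injective fun n : Fin d → ℤ => (N : ℝ)⁻¹ • intVec n :=
    (smul_right_injective _ hN').comp intVec_injective
  rw [← Set.ncard_image_of_injective _ hinj]
  change Set.ncard _ = _
  congr 1
  ext x
  constructor
  · rintro ⟨hx, y, hy, rfl⟩
    rw [SetLike.mem_coe, Module.Basis.mem_span_iff_repr_mem] at hy
    choose n hn using hy
    have : intVec n = y := by
      ext i; simpa [intVec] using hn i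
    exact ⟨n, by simpa [this] using hx, by simp [this]⟩
  · rintro ⟨n, hn, rfl⟩
    refine ⟨hn, intVec n, ?_, rfl⟩
    rw [SetLike.mem_coe, Module.Basis.mem_span_iff_repr_mem]
    exact fun i => ⟨n i, by simp [intVec]⟩

/-- The weighted Riemann sums of the constant function `1` converge to the volume. -/
theorem tendsto_SN_one {P : Set (Fin d → ℝ)} (hc : Convex ℝ P) (hP : IsCompact P) :
    Tendsto (fun N : ℕ => SN d N (fun _ => 1) P) atTop (𝓝 (volume.real P)) := by
  have hint : volume.real (interior P) = volume.real P := by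
    refine measureReal_congr (interior_ae_eq_of_null_frontier (hc.addHaar_frontier volume))
  have hlow := tendsto_card_div_pow_atTop_volume (interior P)
    (hP.isBounded.subset interior_subset) isOpen_interior.measurableSet
    (hc.interior.addHaar_frontier volume)
  have hupp := tendsto_card_div_pow_atTop_volume P hP.isBounded hP.measurableSet
    (hc.addHaar_frontier volume)
  rw [hint] at hlow
  refine tendsto_of_tendsto_of_tendsto_of_le_of_le' hlow hupp ?_ ?_
  · filter_upwards [eventually_gt_atTop 0] with N hN
    have hN' : (N : ℝ)⁻¹ ≠ 0 := by positivity
    have hfin := finite_smul_intVec_mem (hP.isBounded.subset interior_subset) hN'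
    rw [card_smul_intVec_mem _ hN, SN_eq, Fintype.card_fin, div_eq_inv_mul]
    gcongr
    rw [Set.ncard_eq_toFinset_card _ hfin, Finset.card_eq_sum_ones, Nat.cast_sum]
    refine (Finset.sum_le_sum fun n hn => ?_).trans (Summable.sum_le_tsum hfin.toFinset
      (fun n _ => ?_) (summable_of_hasFiniteSupport (finite_support_SN hP (fun _ => 1) hN)))
    · rw [solidAngle_of_mem_interior (hfin.mem_toFinset.1 hn)]
      simp
    · simpa using solidAngle_nonneg hc hP.measurableSet _
  · filter_upwards [eventually_gt_atTop 0] with N hN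
    have hN' : (N : ℝ)⁻¹ ≠ 0 := by positivity
    have hfin := finite_smul_intVec_mem hP.isBounded hN'
    rw [card_smul_intVec_mem _ hN, SN_eq, Fintype.card_fin, div_eq_inv_mul]
    gcongr
    rw [Set.ncard_eq_toFinset_card _ hfin, Finset.card_eq_sum_ones, Nat.cast_sum,
      tsum_eq_sum (s := hfin.toFinset) fun n hn => ?_]
    · refine Finset.sum_le_sum fun n _ => ?_
      simpa using solidAngle_le_one hc hP.measurableSet _
    · rw [solidAngle_of_notMem hP.isClosed (mt hfin.mem_toFinset.2 hn), zero_mul]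

end RiemannSum

section ScaledCopies

variable {d : ℕ} {P : Set (Fin d → ℝ)}

theorem convex_preimage_smul_sub (hc : Convex ℝ P) (c : ℝ) (a : Fin d → ℝ) :
    Convex ℝ {x | c • x - a ∈ P} := by
  intro x hx y hy s t hs ht hst
  have h := hc hx hy hs ht hst
  have e : s • (c • x - a) + t • (c • y - a) = c • (s • x + t • y) - a := by
    have : a = (s + t) • a := by rw [hst, one_smul]
    rw [smul_add, smul_comm c s, smul_comm c t]
    nth_rw 3 [this]
    rw [add_smul]
    simp only [smul_sub]
    abel
  rwa [e] at h

theorem isCompact_preimage_smul_sub (hP : IsCompact P) {c : ℝ} (hc : c ≠ 0) (a : Fin d → ℝ) :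
    IsCompact {x | c • x - a ∈ P} := by
  have e : {x | c • x - a ∈ P} = (fun u => c⁻¹ • (u + a)) '' P := by
    ext x
    constructor
    · exact fun hx => ⟨_, hx, by simp [hc]⟩
    · rintro ⟨u, hu, rfl⟩
      simpa [hc] using hu
  rw [e]
  exact hP.image (by fun_prop)

theorem setIntegral_preimage_smul_sub (hP : MeasurableSet P) {c : ℝ} (hc : 0 < c)
    (a : Fin d → ℝ) (g : (Fin d → ℝ) → ℝ) :
    ∫ x in {x | c • x - a ∈ P}, g x = (c ^ d)⁻¹ * ∫ u in P, g (c⁻¹ • (u + a)) := by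
  have hm : MeasurableSet {x : Fin d → ℝ | c • x - a ∈ P} :=
    (by fun_prop : Measurable fun x : Fin d → ℝ => c • x - a) hP
  rw [← integral_indicator hm, ← integral_indicator hP]
  set h : (Fin d → ℝ) → ℝ := P.indicator fun u => g (c⁻¹ • (u + a)) with hh
  have e : {x : Fin d → ℝ | c • x - a ∈ P}.indicator g = fun x => h (c • x - a) := by
    ext x
    by_cases hx : c • x - a ∈ P
    · rw [Set.indicator_of_mem (by exact hx), hh, Set.indicator_of_mem hx]
      simp [hc.ne']
    · rw [Set.indicator_of_notMem (by exact hx), hh, Set.indicator_of_notMem hx]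
  rw [e, Measure.integral_comp_smul volume (fun x => h (x - a)) c,
    integral_sub_right_eq_self h a, Module.finrank_fintype_fun_eq_card, Fintype.card_fin,
    abs_of_pos (by positivity), smul_eq_mul]

/-- The integer points of a compact set. -/
noncomputable def integerPoints (hP : IsCompact P) : Finset (Fin d → ℤ) :=
  (finite_smul_intVec_mem hP.isBounded one_ne_zero).toFinset

theorem mem_integerPoints {hP : IsCompact P} {n : Fin d → ℤ} :
    n ∈ integerPoints hP ↔ intVec n ∈ P := by
  simp [integerPoints]

theorem SN_preimage_smul_sub (hc : Convex ℝ P) (hP : IsCompact P) (m : Fin d → ℤ)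
    (g : (Fin d → ℝ) → ℝ) {N : ℕ} (hN : 0 < N) :
    SN d N g {x | (N : ℝ) • x - intVec m ∈ P} = ((N : ℝ) ^ d)⁻¹ *
      ∑ n ∈ integerPoints hP,
        solidAngle d P (intVec n) * g ((N : ℝ)⁻¹ • (intVec n + intVec m)) := by
  have hN' : (0 : ℝ) < N := by exact_mod_cast hN
  rw [SN_eq]
  congr 1
  simp only [solidAngle_preimage hc hP.measurableSet hN', smul_inv_smul₀ hN'.ne', ← intVec_sub]
  rw [← (Equiv.addRight m).tsum_eq, tsum_eq_sum (s := integerPoints hP)]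
  · refine Finset.sum_congr rfl fun n _ => ?_
    simp [intVec_add]
  · intro n hn
    rw [mem_integerPoints] at hn
    simp [solidAngle_of_notMem hP.isClosed hn]

end ScaledCopies

section CentrallySymmetric

variable {d : ℕ} {P : Set (Fin d → ℝ)} {z : Fin d → ℝ}

/-- The average over `P` with respect to Lebesgue measure, centred at `z`. -/
noncomputable def volumeMean (hP : IsCompact P) (z : Fin d → ℝ) : C(Fin d → ℝ, ℝ) →ₗ[ℝ] ℝ where
  toFun f := (volume.real P)⁻¹ * ∫ u in P, f (u - z)
  map_add' f g := by
    simp only [ContinuousMap.add_apply]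
    rw [integral_add, mul_add]
    · exact ContinuousOn.integrableOn_compact hP (by fun_prop)
    · exact ContinuousOn.integrableOn_compact hP (by fun_prop)
  map_smul' c f := by
    simp only [ContinuousMap.smul_apply, smul_eq_mul, RingHom.id_apply, integral_const_mul]
    ring

/-- The average over the integer points of `P` weighted by solid angles, centred at `z`. -/
noncomputable def latticeMean (hP : IsCompact P) (z : Fin d → ℝ) : C(Fin d → ℝ, ℝ) →ₗ[ℝ] ℝ where
  toFun f := (volume.real P)⁻¹ *
    ∑ n ∈ integerPoints hP, solidAngle d P (intVec n) * f (intVec n - z)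
  map_add' f g := by
    simp only [ContinuousMap.add_apply, mul_add, Finset.sum_add_distrib]
  map_smul' c f := by
    simp only [ContinuousMap.smul_apply, smul_eq_mul, RingHom.id_apply, Finset.mul_sum]
    exact Finset.sum_congr rfl fun n _ => by ring

theorem isSymmMean_volumeMean (hP : IsCompact P) (hpos : 0 < volume.real P) {s : Fin d → ℝ}
    (hs : s = z + z) (hsymm : ∀ u, s - u ∈ P ↔ u ∈ P) {R : ℝ}
    (hR : ∀ u ∈ P, u - z ∈ Metric.closedBall 0 R) : IsSymmMean (volumeMean hP z) R where
  bound f M h := by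
    have h1 : ‖∫ u in P, f (u - z)‖ ≤ M * volume.real P :=
      norm_setIntegral_le_of_norm_le_const hP.measure_lt_top fun u hu => h _ (hR u hu)
    change |(volume.real P)⁻¹ * ∫ u in P, f (u - z)| ≤ M
    rw [abs_mul, abs_of_pos (inv_pos.2 hpos), inv_mul_le_iff₀ hpos, mul_comm]
    exact h1
  neg f := by
    change (volume.real P)⁻¹ * ∫ u in P, f (-(u - z)) = (volume.real P)⁻¹ * ∫ u in P, f (u - z)
    congr 1
    rw [← integral_indicator hP.measurableSet, ← integral_indicator hP.measurableSet,
      ← integral_sub_left_eq_self _ volume s]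
    refine integral_congr_ae (ae_of_all _ fun u => ?_)
    by_cases hu : u ∈ P
    · have hu' := (hsymm u).2 hu
      have e : -(s - u - z) = u - z := by rw [hs]; abel
      simp only [Set.indicator_of_mem hu, Set.indicator_of_mem hu', e]
    · have hu' := mt (hsymm u).1 hu
      simp only [Set.indicator_of_notMem hu, Set.indicator_of_notMem hu']
  one := by
    change (volume.real P)⁻¹ * ∫ u in P, (1 : ℝ) = 1
    simp [hpos.ne']

theorem isSymmMean_latticeMean (hc : Convex ℝ P) (hP : IsCompact P) (hpos : 0 < volume.real P)
    (hvol : ∑ n ∈ integerPoints hP, solidAngle d P (intVec n) = volume.real P)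
    {s : Fin d → ℤ} (hs : intVec s = z + z) (hsymm : ∀ u, intVec s - u ∈ P ↔ u ∈ P) {R : ℝ}
    (hR : ∀ u ∈ P, u - z ∈ Metric.closedBall 0 R) : IsSymmMean (latticeMean hP z) R where
  bound f M h := by
    change |(volume.real P)⁻¹ *
      ∑ n ∈ integerPoints hP, solidAngle d P (intVec n) * f (intVec n - z)| ≤ M
    rw [abs_mul, abs_of_pos (inv_pos.2 hpos), inv_mul_le_iff₀ hpos, ← hvol, Finset.sum_mul]
    refine (Finset.abs_sum_le_sum_abs _ _).trans (Finset.sum_le_sum fun n hn => ?_)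
    have h0 := solidAngle_nonneg hc hP.measurableSet (intVec n)
    rw [abs_mul, abs_of_nonneg h0]
    exact mul_le_mul_of_nonneg_left (h _ (hR _ (mem_integerPoints.1 hn))) h0
  neg f := by
    change (volume.real P)⁻¹ *
      ∑ n ∈ integerPoints hP, solidAngle d P (intVec n) * f (-(intVec n - z)) =
      (volume.real P)⁻¹ * ∑ n ∈ integerPoints hP, solidAngle d P (intVec n) * f (intVec n - z)
    congr 1
    refine Finset.sum_equiv (Equiv.subLeft s) (fun n => ?_) fun n _ => ?_
    · simp only [mem_integerPoints, Equiv.subLeft_apply, intVec_sub, hsymm]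
    · simp only [Equiv.subLeft_apply, intVec_sub, solidAngle_sub_left hsymm]
      congr 2
      rw [hs]
      abel
  one := by
    change (volume.real P)⁻¹ * ∑ n ∈ integerPoints hP, solidAngle d P (intVec n) * (1 : ℝ) = 1
    simp [hvol, hpos.ne']

end CentrallySymmetric

theorem volume_coord_eq_null {d : ℕ} {ι : Type*} (b : Module.Basis ι ℝ (Fin d → ℝ))
    (v : Fin d → ℝ) (i : ι) (c : ℝ) :
    volume {x : Fin d → ℝ | b.repr (x - v) i = c} = 0 := by
  set S : AffineSubspace ℝ (Fin d → ℝ) :=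
    AffineSubspace.mk' (v + c • b i) (LinearMap.ker (b.coord i)) with hS
  have hmem : ∀ x, x ∈ S ↔ b.repr (x - v) i = c := fun x => by
    rw [hS, AffineSubspace.mem_mk', LinearMap.mem_ker, vsub_eq_sub, ← sub_sub, map_sub, map_smul,
      Module.Basis.coord_apply, Module.Basis.coord_apply, Module.Basis.repr_self,
      Finsupp.single_eq_same, smul_eq_mul, mul_one, sub_eq_zero]
  have hne : S ≠ ⊤ := by
    intro h
    have h1 : v + (c + 1) • b i ∈ S := h ▸ AffineSubspace.mem_top ℝ _ _
    rw [hmem, add_sub_cancel_left, map_smul, Module.Basis.repr_self] at h1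
    simp at h1
  have e : {x : Fin d → ℝ | b.repr (x - v) i = c} = S := Set.ext fun x => (hmem x).symm
  rw [e]
  exact Measure.addHaar_affineSubspace volume S hne

section Parallelepiped

variable {d : ℕ} {ι : Type*} [Fintype ι] (b : Module.Basis ι ℝ (Fin d → ℝ))

theorem mem_parallelepiped_basis {u : Fin d → ℝ} :
    u ∈ parallelepiped b ↔ ∀ i, b.repr u i ∈ Set.Icc (0 : ℝ) 1 := by
  rw [parallelepiped_basis_eq]
  rfl

theorem isCompact_parallelepiped : IsCompact (parallelepiped b) := b.parallelepiped.isCompact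

theorem volume_real_parallelepiped_pos : 0 < volume.real (parallelepiped b) :=
  ENNReal.toReal_pos (Measure.measure_pos_of_nonempty_interior _
    b.parallelepiped.interior_nonempty).ne'
    (isCompact_parallelepiped b).measure_lt_top.ne

theorem sum_sub_mem_parallelepiped (u : Fin d → ℝ) :
    ∑ i, b i - u ∈ parallelepiped b ↔ u ∈ parallelepiped b := by
  classical
  simp only [mem_parallelepiped_basis, map_sub, map_sum, Module.Basis.repr_self, Finsupp.coe_sub,
    Pi.sub_apply, Finsupp.finsetSum_apply, Finsupp.single_apply, Finset.sum_ite_eq',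
    Finset.mem_univ, if_true, Set.mem_Icc]
  refine forall_congr' fun i => ?_
  constructor <;> rintro ⟨h1, h2⟩ <;> constructor <;> linarith

/-- The lower corner of the tile with multi-index `j` in the parallelepiped at `v`, dilated by
`N`. -/
noncomputable def tileCorner (v : Fin d → ℝ) (N : ℕ) (j : ι → Fin N) : Fin d → ℝ :=
  (N : ℝ) • v + ∑ i, (j i : ℝ) • b i

/-- The tiles of side `1 / N` in the parallelepiped at `v` spanned by `b`. -/
def tile (v : Fin d → ℝ) (N : ℕ) (j : ι → Fin N) : Set (Fin d → ℝ) :=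
  {x | (N : ℝ) • x - tileCorner b v N j ∈ parallelepiped b}

theorem mem_tile {v x : Fin d → ℝ} {N : ℕ} {j : ι → Fin N} :
    x ∈ tile b v N j ↔ ∀ i, (N : ℝ) * b.repr (x - v) i - j i ∈ Set.Icc (0 : ℝ) 1 := by
  classical
  change (N : ℝ) • x - tileCorner b v N j ∈ parallelepiped b ↔ _
  rw [mem_parallelepiped_basis]
  refine forall_congr' fun i => ?_
  have : b.repr ((N : ℝ) • x - tileCorner b v N j) i = (N : ℝ) * b.repr (x - v) i - j i := by
    simp only [tileCorner, ← sub_sub, ← smul_sub, map_sub, map_smul, map_sum,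
      Module.Basis.repr_self, Finsupp.coe_sub, Pi.sub_apply, Finsupp.finsetSum_apply,
      Finsupp.coe_smul, Pi.smul_apply, Finsupp.single_apply, smul_eq_mul, mul_ite, mul_one,
      mul_zero, Finset.sum_ite_eq', Finset.mem_univ, if_true]
  rw [this]

theorem iUnion_tile (v : Fin d → ℝ) {N : ℕ} (hN : 0 < N) :
    ⋃ j, tile b v N j = {x | x - v ∈ parallelepiped b} := by
  have hN' : (0 : ℝ) < N := by exact_mod_cast hN
  ext x
  simp only [Set.mem_iUnion, mem_tile, Set.mem_ofPred_eq, mem_parallelepiped_basis, Set.mem_Icc]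
  constructor
  · rintro ⟨j, hj⟩ i
    obtain ⟨h1, h2⟩ := hj i
    have h3 : ((j i : ℕ) : ℝ) + 1 ≤ N := by exact_mod_cast (j i).2
    have h4 : (0 : ℝ) ≤ ((j i : ℕ) : ℝ) := by positivity
    constructor
    · exact nonneg_of_mul_nonneg_right (by linarith) hN'
    · exact le_of_mul_le_mul_left (by linarith) hN'
  · intro h
    refine ⟨fun i => ⟨min ⌊(N : ℝ) * b.repr (x - v) i⌋₊ (N - 1), by omega⟩, fun i => ?_⟩
    obtain ⟨h1, h2⟩ := h i
    have h3 : 0 ≤ (N : ℝ) * b.repr (x - v) i := by positivity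
    have h4 := Nat.floor_le h3
    have h5 := Nat.lt_floor_add_one ((N : ℝ) * b.repr (x - v) i)
    have h6 : (N : ℝ) * b.repr (x - v) i ≤ N := by nlinarith
    simp only
    rcases min_cases ⌊(N : ℝ) * b.repr (x - v) i⌋₊ (N - 1) with ⟨h7, h8⟩ | ⟨h7, h8⟩
    · rw [h7]
      constructor <;> linarith
    · rw [h7]
      have h9 : ((N - 1 : ℕ) : ℝ) ≤ ⌊(N : ℝ) * b.repr (x - v) i⌋₊ := by exact_mod_cast h8.le
      have h10 : ((N - 1 : ℕ) : ℝ) = N - 1 := by rw [Nat.cast_sub hN]; simp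
      constructor <;> linarith

theorem volume_tile_inter_tile (v : Fin d → ℝ) {N : ℕ} {j k : ι → Fin N} (hjk : j ≠ k) :
    volume (tile b v N j ∩ tile b v N k) = 0 := by
  obtain ⟨i, hi⟩ := Function.ne_iff.1 hjk
  have hN : 0 < N := (j i).pos
  have hN' : (0 : ℝ) < N := by exact_mod_cast hN
  have main : ∀ j k : ι → Fin N, j i < k i →
      volume (tile b v N j ∩ tile b v N k) = 0 := fun j k hlt => by
    refine measure_mono_null (fun x hx => ?_)
      (volume_coord_eq_null b v i ((N : ℝ)⁻¹ * ((k i : ℕ) : ℝ)))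
    have h1 := ((mem_tile b).1 hx.1 i).2
    have h2 := ((mem_tile b).1 hx.2 i).1
    have h3 : ((j i : ℕ) : ℝ) + 1 ≤ (k i : ℕ) := by exact_mod_cast hlt
    rw [Set.mem_ofPred_eq, eq_inv_mul_iff_mul_eq₀ hN'.ne']
    linarith
  rcases lt_or_gt_of_ne hi with h | h
  · exact main j k h
  · rw [Set.inter_comm]
    exact main k j h

theorem convex_tile (v : Fin d → ℝ) (N : ℕ) (j : ι → Fin N) : Convex ℝ (tile b v N j) :=
  convex_preimage_smul_sub (convex_parallelepiped b) _ _

theorem isCompact_tile (v : Fin d → ℝ) {N : ℕ} (hN : 0 < N) (j : ι → Fin N) :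
    IsCompact (tile b v N j) :=
  isCompact_preimage_smul_sub (isCompact_parallelepiped b) (by positivity) _

theorem SN_parallelepiped (hb : ∀ i, ∃ m, b i = intVec m) (v : Fin d → ℤ)
    (g : (Fin d → ℝ) → ℝ) {N : ℕ} (hN : 0 < N) [DecidableEq ι] :
    SN d N g {x | x - intVec v ∈ parallelepiped b} = ((N : ℝ) ^ d)⁻¹ *
      ∑ j : ι → Fin N, ∑ n ∈ integerPoints (isCompact_parallelepiped b),
        solidAngle d (parallelepiped b) (intVec n) *
          g ((N : ℝ)⁻¹ • (intVec n + tileCorner b (intVec v) N j)) := by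
  choose m hm using hb
  have hcorner : ∀ j : ι → Fin N, tileCorner b (intVec v) N j =
      intVec ((N : ℤ) • v + ∑ i, ((j i : ℕ) : ℤ) • m i) := fun j => by
    ext l
    simp [tileCorner, intVec, hm]
  have hunion : {x | x - intVec v ∈ parallelepiped b} =
      ⋃ j ∈ (Finset.univ : Finset (ι → Fin N)), tile b (intVec v) N j := by
    simp [iUnion_tile b _ hN]
  rw [SN_eq_sum (Finset.univ : Finset (ι → Fin N)) (Q := tile b (intVec v) N) (g := fun _ => g)
    (fun j _ => isCompact_tile b _ hN j) (fun x => ?_) hN, Finset.mul_sum]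
  · refine Finset.sum_congr rfl fun j _ => ?_
    rw [tile, hcorner]
    exact SN_preimage_smul_sub (convex_parallelepiped b) (isCompact_parallelepiped b) _ g hN
  · rw [← Finset.sum_mul, hunion, solidAngle_biUnion _ (fun j _ => convex_tile b _ N j)
      (fun j _ => (isCompact_tile b _ hN j).measurableSet)
      (fun j _ k _ hjk => volume_tile_inter_tile b _ hjk)]

theorem setIntegral_parallelepiped (v : Fin d → ℝ) (g : C(Fin d → ℝ, ℝ)) {N : ℕ} (hN : 0 < N)
    [DecidableEq ι] :
    ∫ x in {x | x - v ∈ parallelepiped b}, g x = ((N : ℝ) ^ d)⁻¹ *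
      ∑ j : ι → Fin N, ∫ u in parallelepiped b, g ((N : ℝ)⁻¹ • (u + tileCorner b v N j)) := by
  have hunion : {x | x - v ∈ parallelepiped b} =
      ⋃ j ∈ (Finset.univ : Finset (ι → Fin N)), tile b v N j := by
    simp [iUnion_tile b _ hN]
  rw [hunion, setIntegral_biUnion_of_null _
      (fun j _ => (isCompact_tile b _ hN j).measurableSet)
      (fun j _ k _ hjk => volume_tile_inter_tile b _ hjk)
      (fun j _ => g.continuous.continuousOn.integrableOn_compact (isCompact_tile b _ hN j)),
    Finset.mul_sum]
  exact Finset.sum_congr rfl fun j _ => setIntegral_preimage_smul_sub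
    (isCompact_parallelepiped b).measurableSet (by exact_mod_cast hN) _ g

theorem card_pi_fin (b : Module.Basis ι ℝ (Fin d → ℝ)) (N : ℕ) [DecidableEq ι] :
    Fintype.card (ι → Fin N) = N ^ d := by
  rw [Fintype.card_fun, Fintype.card_fin, ← Module.finrank_eq_card_basis b,
    Module.finrank_fintype_fun_eq_card, Fintype.card_fin]

theorem sum_solidAngle_parallelepiped (hb : ∀ i, ∃ m, b i = intVec m) :
    ∑ n ∈ integerPoints (isCompact_parallelepiped b), solidAngle d (parallelepiped b) (intVec n) =
      volume.real (parallelepiped b) := by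
  classical
  refine tendsto_nhds_unique (Tendsto.congr' ?_ tendsto_const_nhds)
    (tendsto_SN_one (convex_parallelepiped b) (isCompact_parallelepiped b))
  filter_upwards [eventually_gt_atTop 0] with N hN
  have h := SN_parallelepiped b hb 0 (fun _ => 1) hN
  have h0 : (intVec 0 : Fin d → ℝ) = 0 := by ext; simp [intVec]
  simp only [h0, sub_zero, Set.ofPred_mem_eq, mul_one, Finset.sum_const, Finset.card_univ,
    card_pi_fin b, nsmul_eq_mul, Nat.cast_pow] at h
  rw [h, inv_mul_cancel_left₀ (by positivity)]

/-- The even expansion of the weighted Riemann sums over an integral parallelepiped. -/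
theorem hasEvenExpansion_parallelepiped (hb : ∀ i, ∃ m, b i = intVec m) (v : Fin d → ℤ) (w : ℕ)
    {g : (Fin d → ℝ) → ℝ} (hg : ContDiff ℝ (w + 1) g) :
    HasEvenExpansion w (fun N => SN d N g {x | x - intVec v ∈ parallelepiped b})
      (∫ x in {x | x - intVec v ∈ parallelepiped b}, g x) := by
  classical
  set P := parallelepiped b with hPdef
  have hP : IsCompact P := isCompact_parallelepiped b
  have hpos : 0 < volume.real P := volume_real_parallelepiped_pos b
  set z : Fin d → ℝ := (2 : ℝ)⁻¹ • ∑ i, b i with hz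
  have hzz : ∑ i, b i = z + z := by rw [hz, ← two_smul ℝ, smul_inv_smul₀ two_ne_zero]
  have hzP : z ∈ P := by
    rw [hPdef, mem_parallelepiped_basis]
    intro i
    simp [hz, Finsupp.single_apply]
    norm_num
  obtain ⟨s, hs⟩ : ∃ s, ∑ i, b i = intVec s := by
    choose m hm using hb
    exact ⟨∑ i, m i, by ext l; simp [intVec, hm]⟩
  have hD : IsCompact {x | x - intVec v ∈ P} := by
    simpa using isCompact_preimage_smul_sub hP one_ne_zero (intVec v)
  have hQ : IsCompact ((fun u => u - z) '' P) := hP.image (by fun_prop)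
  obtain ⟨R, hR⟩ := (hD.union hQ).isBounded.subset_closedBall 0
  have hRP : ∀ u ∈ P, u - z ∈ Metric.closedBall 0 R := fun u hu => hR (Or.inr ⟨u, hu, rfl⟩)
  have hR0 : 0 ≤ R := dist_nonneg.trans (hRP z hzP)
  let c : ∀ N : ℕ, (ι → Fin N) → (Fin d → ℝ) := fun N j =>
    (N : ℝ)⁻¹ • (tileCorner b (intVec v) N j + z)
  have hcell : ∀ (N : ℕ) (j : ι → Fin N) (u : Fin d → ℝ),
      c N j + (N : ℝ)⁻¹ • (u - z) = (N : ℝ)⁻¹ • (u + tileCorner b (intVec v) N j) :=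
    fun N j u => by
      rw [← smul_add]
      congr 1
      abel
  have hc : ∀ N, 0 < N → ∀ j, c N j ∈ Metric.closedBall 0 R := fun N hN j => by
    refine hR (Or.inl ?_)
    rw [← iUnion_tile b _ hN]
    refine Set.mem_iUnion.2 ⟨j, ?_⟩
    change (N : ℝ) • c N j - tileCorner b (intVec v) N j ∈ P
    rw [smul_inv_smul₀ (by positivity), add_sub_cancel_left]
    exact hzP
  have key := hasEvenExpansion_sampleMean c hR0 hc
    (isSymmMean_volumeMean hP hpos hzz (sum_sub_mem_parallelepiped b) hRP)
    (fun g => (volume.real P)⁻¹ * ∫ x in {x | x - intVec v ∈ P}, g x)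
    (fun g N hN => ?_) w
    (isSymmMean_latticeMean (convex_parallelepiped b) hP hpos (sum_solidAngle_parallelepiped b hb)
      (hs ▸ hzz) (hs ▸ sum_sub_mem_parallelepiped b) hRP) ⟨g, hg.continuous⟩ hg
  · have := key.const_mul (volume.real P)
    rw [mul_inv_cancel_left₀ hpos.ne'] at this
    refine this.congr fun N hN => ?_
    rw [SN_parallelepiped b hb v g hN, sampleMean, card_pi_fin b, Nat.cast_pow, mul_left_comm]
    congr 1
    rw [Finset.mul_sum]
    refine Finset.sum_congr rfl fun j _ => ?_
    change _ = _ * ((volume.real P)⁻¹ * ∑ n ∈ integerPoints hP,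
      solidAngle d P (intVec n) * g (c N j + (N : ℝ)⁻¹ • (intVec n - z)))
    rw [mul_inv_cancel_left₀ hpos.ne']
    simp only [hcell]
    rfl
  · rw [setIntegral_parallelepiped b (intVec v) g hN, sampleMean, card_pi_fin b, Nat.cast_pow,
      mul_left_comm]
    congr 1
    rw [Finset.mul_sum]
    refine Finset.sum_congr rfl fun j _ => ?_
    change (volume.real P)⁻¹ * ∫ u in P, g (c N j + (N : ℝ)⁻¹ • (u - z)) = _
    simp only [hcell]
    rfl

end Parallelepiped

section Simplex

variable {d : ℕ} {ι : Type*} (β : AffineBasis ι ℝ (Fin d → ℝ))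

theorem basisOf_repr_sub (i : ι) (j : {j // j ≠ i}) (x : Fin d → ℝ) :
    (β.basisOf i).repr (x - β i) j = β.coord j x := by
  classical
  have h : (β.coord j).linear = (β.basisOf i).coord j := by
    refine (β.basisOf i).ext fun k => ?_
    rw [Module.Basis.coord_apply, Module.Basis.repr_self, AffineBasis.basisOf_apply,
      AffineMap.linearMap_vsub, β.coord_apply, β.coord_apply_ne j.2, vsub_eq_sub, sub_zero,
      Finsupp.single_apply]
    simp only [Subtype.ext_iff, eq_comm]
  rw [← Module.Basis.coord_apply, ← h, ← vsub_eq_sub, AffineMap.linearMap_vsub,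
    β.coord_apply_ne j.2, vsub_eq_sub, sub_zero]

variable [Fintype ι]

/-- The region where the simplex coincides with the parallelepiped spanned by its edges at the
vertex `i`. -/
def cornerRegion (i : ι) : Set (Fin d → ℝ) :=
  {x | 0 < β.coord i x} ∩ ⋂ j : {j // j ≠ i}, {x | β.coord j x < 1}

theorem isOpen_cornerRegion (i : ι) : IsOpen (cornerRegion β i) :=
  (isOpen_lt continuous_const (continuous_barycentric_coord β i)).inter
    (isOpen_iInter_of_finite fun j =>
      isOpen_lt (continuous_barycentric_coord β j.1) continuous_const)

theorem convexHull_subset_iUnion_cornerRegion :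
    convexHull ℝ (Set.range β) ⊆ ⋃ i, cornerRegion β i := by
  classical
  intro x hx
  rw [β.convexHull_eq_nonneg_coord] at hx
  have hsum := β.sum_coord_apply_eq_one x
  obtain ⟨i, hi⟩ : ∃ i, 0 < β.coord i x := by
    by_contra! h
    linarith [Finset.sum_nonpos fun i (_ : i ∈ Finset.univ) => h i]
  refine Set.mem_iUnion.2 ⟨i, hi, Set.mem_iInter.2 fun j => ?_⟩
  have h := Finset.sum_le_sum_of_subset_of_nonneg (Finset.subset_univ {i, j.1})
    fun k _ _ => hx k
  rw [Finset.sum_pair j.2.symm, hsum] at h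
  change β.coord j x < 1
  linarith

theorem mem_convexHull_iff_of_mem_cornerRegion [DecidableEq ι] {i : ι} {x : Fin d → ℝ}
    (hx : x ∈ cornerRegion β i) :
    x ∈ convexHull ℝ (Set.range β) ↔ x - β i ∈ parallelepiped (β.basisOf i) := by
  rw [β.convexHull_eq_nonneg_coord, mem_parallelepiped_basis]
  simp only [basisOf_repr_sub]
  constructor
  · exact fun h j => ⟨h j, (Set.mem_iInter.1 hx.2 j).le⟩
  · intro h j
    by_cases hj : j = i
    · exact hj ▸ (hx.1).le
    · exact (h ⟨j, hj⟩).1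

/-- The even expansion of the weighted Riemann sums over an integral simplex. -/
theorem hasEvenExpansion_simplex (hβ : ∀ i, ∃ m, β i = intVec m) (w : ℕ)
    {f : (Fin d → ℝ) → ℝ} (hf : ContDiff ℝ (w + 1) f) :
    HasEvenExpansion w (fun N => SN d N f (convexHull ℝ (Set.range β)))
      (∫ x in convexHull ℝ (Set.range β), f x) := by
  classical
  set T := convexHull ℝ (Set.range β) with hTdef
  have hT : IsCompact T := (Set.finite_range β).isCompact_convexHull ℝ
  obtain ⟨χ, hχ⟩ := SmoothPartitionOfUnity.exists_isSubordinate
    (modelWithCornersSelf ℝ (Fin d → ℝ)) hT.isClosed (cornerRegion β) (isOpen_cornerRegion β)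
    (convexHull_subset_iUnion_cornerRegion β)
  have hsum : ∀ x ∈ T, ∑ i, χ i x = 1 := fun x hx => by
    rw [← finsum_eq_sum_of_fintype]
    exact χ.sum_eq_one hx
  have hmem : ∀ i x, χ i x ≠ 0 → x ∈ cornerRegion β i := fun i x hx =>
    hχ i (subset_tsupport _ hx)
  have hsmooth : ∀ i, ContDiff ℝ (w + 1) fun x => χ i x * f x := fun i =>
    ((χ i).contMDiff.contDiff.of_le (by exact_mod_cast le_top)).mul hf
  choose m hm using hβ
  let D : ι → Set (Fin d → ℝ) := fun i => {x | x - β i ∈ parallelepiped (β.basisOf i)}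
  have hD : ∀ i, IsCompact (D i) := fun i => by
    simpa using isCompact_preimage_smul_sub (isCompact_parallelepiped (β.basisOf i))
      one_ne_zero (β i)
  have hlocal : ∀ i x, x ∈ cornerRegion β i → (x ∈ T ↔ x ∈ D i) := fun i x hx =>
    mem_convexHull_iff_of_mem_cornerRegion β hx
  have hangle : ∀ x, solidAngle d T x * f x = ∑ i, solidAngle d (D i) x * (χ i x * f x) := by
    intro x
    have h : ∀ i, solidAngle d (D i) x * (χ i x * f x) = solidAngle d T x * f x * χ i x := by
      intro i
      by_cases h0 : χ i x = 0
      · simp [h0]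
      · rw [solidAngle_congr ((isOpen_cornerRegion β i).mem_nhds (hmem i x h0)) (hlocal i)]
        ring
    simp only [h, ← Finset.mul_sum]
    by_cases hx : x ∈ T
    · rw [hsum x hx, mul_one]
    · simp [solidAngle_of_notMem hT.isClosed hx]
  have hintegral : ∫ x in T, f x = ∑ i, ∫ x in D i, χ i x * f x := by
    have h : ∀ i, ∫ x in D i, χ i x * f x = ∫ x in T, χ i x * f x := fun i => by
      rw [← integral_indicator (hD i).measurableSet, ← integral_indicator hT.measurableSet]
      refine integral_congr_ae (ae_of_all _ fun x => ?_)
      by_cases h0 : χ i x = 0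
      · simp [Set.indicator, h0]
      · simp [Set.indicator, hlocal i x (hmem i x h0)]
    simp only [h]
    rw [← integral_finsetSum _ fun i _ =>
      (hsmooth i).continuous.continuousOn.integrableOn_compact hT]
    refine setIntegral_congr_fun hT.measurableSet fun x hx => ?_
    simp only [← Finset.sum_mul, hsum x hx, one_mul]
  rw [hintegral]
  refine (HasEvenExpansion.sum Finset.univ (F := fun i N => SN d N (fun x => χ i x * f x) (D i))
    fun i _ => ?_).congr fun N hN => SN_eq_sum Finset.univ (fun i _ => hD i) hangle hN
  have hedge : ∀ j, ∃ n, β.basisOf i j = intVec n := fun j =>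
    ⟨m j - m i, by rw [AffineBasis.basisOf_apply, hm, hm, intVec_sub, vsub_eq_sub]⟩
  have h := hasEvenExpansion_parallelepiped (β.basisOf i) hedge (m i) w (hsmooth i)
  rwa [← hm] at h

end Simplex

section SimplicialComplex

variable {d : ℕ} (K : Geometry.SimplicialComplex ℝ (Fin d → ℝ))

theorem volume_convexHull_inter_convexHull {s t : Finset (Fin d → ℝ)} (hs : s ∈ K.faces)
    (ht : t ∈ K.faces) (hcard : s.card = t.card) (hne : s ≠ t) :
    volume (convexHull ℝ (s : Set (Fin d → ℝ)) ∩ convexHull ℝ (t : Set (Fin d → ℝ))) = 0 := by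
  obtain ⟨p, hps, hpt⟩ : ∃ p ∈ s, p ∉ t := by
    by_contra! h
    exact hne (Finset.eq_of_subset_of_card_le h hcard.ge)
  have hp := (K.indep hs).notMem_affineSpan_sdiff ⟨p, hps⟩ Set.univ
  have hspan : affineSpan ℝ (Subtype.val '' (Set.univ \ {(⟨p, hps⟩ : s)})) ≠ ⊤ := fun h =>
    hp (h ▸ AffineSubspace.mem_top ℝ _ _)
  refine measure_mono_null ?_ (Measure.addHaar_affineSubspace volume _ hspan)
  refine (K.inter_subset_convexHull hs ht).trans ((convexHull_mono ?_).trans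
    (convexHull_subset_affineSpan _))
  rintro q ⟨hqs, hqt⟩
  refine ⟨⟨q, hqs⟩, ⟨trivial, fun h => hpt ?_⟩, rfl⟩
  have hqp : q = p := congrArg Subtype.val h
  exact hqp ▸ hqt

/-- The even expansion of the weighted Riemann sums over a homogeneous simplicial complex with
integer vertices. -/
theorem hasEvenExpansion_simplicialComplex (hfin : K.faces.Finite)
    (hint : ∀ s ∈ K.faces, ∀ p ∈ s, ∀ i : Fin d, ∃ z : ℤ, p i = (z : ℝ))
    (hhom : ∀ s ∈ K.faces, ∃ t ∈ K.faces, s ⊆ t ∧ t.card = d + 1)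
    (w : ℕ) {f : (Fin d → ℝ) → ℝ} (hf : ContDiff ℝ (w + 1) f) :
    HasEvenExpansion w (fun N => SN d N f K.space) (∫ x in K.space, f x) := by
  classical
  let S : Finset (Finset (Fin d → ℝ)) := {s ∈ hfin.toFinset | s.card = d + 1}
  have hS : ∀ s, s ∈ S ↔ s ∈ K.faces ∧ s.card = d + 1 := fun s => by simp [S]
  let T : Finset (Fin d → ℝ) → Set (Fin d → ℝ) := fun s => convexHull ℝ (s : Set (Fin d → ℝ))
  have hT : ∀ s ∈ S, IsCompact (T s) := fun s _ => s.finite_toSet.isCompact_convexHull ℝ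
  have hspace : K.space = ⋃ s ∈ S, T s := by
    refine Set.Subset.antisymm ?_ ?_
    · refine Set.iUnion₂_subset fun s hs => ?_
      obtain ⟨t, ht, hst, hcard⟩ := hhom s hs
      exact (convexHull_mono (Finset.coe_subset.2 hst)).trans
        (Set.subset_biUnion_of_mem (u := T) ((hS t).2 ⟨ht, hcard⟩))
    · exact Set.iUnion₂_subset fun s hs => K.convexHull_subset_space ((hS s).1 hs).1
  have hnull : ∀ s ∈ S, ∀ t ∈ S, s ≠ t → volume (T s ∩ T t) = 0 := fun s hs t ht hst =>
    volume_convexHull_inter_convexHull K ((hS s).1 hs).1 ((hS t).1 ht).1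
      (((hS s).1 hs).2.trans ((hS t).1 ht).2.symm) hst
  rw [hspace, setIntegral_biUnion_of_null S (fun s hs => (hT s hs).measurableSet) hnull
    fun s hs => hf.continuous.continuousOn.integrableOn_compact (hT s hs)]
  refine (HasEvenExpansion.sum S (F := fun s N => SN d N f (T s)) fun s hs => ?_).congr
    fun N hN => SN_eq_sum S hT (fun x => ?_) hN
  · have hind := K.indep ((hS s).1 hs).1
    have htop : affineSpan ℝ (Set.range ((↑) : s → Fin d → ℝ)) = ⊤ := by
      rw [hind.affineSpan_eq_top_iff_card_eq_finrank_add_one, Fintype.card_coe, ((hS s).1 hs).2,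
        Module.finrank_fintype_fun_eq_card, Fintype.card_fin]
    have h := hasEvenExpansion_simplex (AffineBasis.mk _ hind htop) (fun p => ?_) w hf
    · have e : Set.range (AffineBasis.mk _ hind htop) = (s : Set (Fin d → ℝ)) :=
        Subtype.range_coe
      rwa [e] at h
    · choose n hn using hint s ((hS s).1 hs).1 p p.2
      exact ⟨n, funext hn⟩
  · rw [← Finset.sum_mul, solidAngle_biUnion S (fun s _ => convex_convexHull ℝ _)
      (fun s hs => (hT s hs).measurableSet) hnull]

end SimplicialComplex

theorem stmt18 (d : ℕ) (hd : 1 ≤ d)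
    (K : Geometry.SimplicialComplex ℝ (Fin d → ℝ))
    (hfin : K.faces.Finite)
    (hint : ∀ s ∈ K.faces, ∀ p ∈ s, ∀ i : Fin d, ∃ z : ℤ, p i = (z : ℝ))
    (hhom : ∀ s ∈ K.faces, ∃ t ∈ K.faces, s ⊆ t ∧ t.card = d + 1)
    (w : ℕ) (f : (Fin d → ℝ) → ℝ) (hf : ContDiff ℝ (w + 1) f) :
    ∃ γ : ℕ → ℝ, ∃ C : ℝ, ∀ N : ℕ, 0 < N →
      |SN d N f K.space - (∫ x in K.space, f x)
          - ∑ k ∈ Finset.Icc 1 (w / 2), γ k * (N : ℝ) ^ (-(2 * k : ℤ))|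
        ≤ C * (N : ℝ) ^ (-(w : ℤ) - 1) := by
  obtain ⟨γ, C, h⟩ := hasEvenExpansion_simplicialComplex K hfin hint hhom w hf
  refine ⟨γ, C, fun N hN => ?_⟩
  have e₁ : ∀ k : ℕ, (N : ℝ) ^ (-(2 * k : ℤ)) = ((N : ℝ)⁻¹) ^ (2 * k) := fun k => by
    rw [zpow_neg, inv_pow]
    norm_cast
  have e₂ : (N : ℝ) ^ (-(w : ℤ) - 1) = ((N : ℝ)⁻¹) ^ (w + 1) := by
    rw [← neg_add', zpow_neg, inv_pow]
    norm_cast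
  simpa only [e₁, e₂] using h N hN
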